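/- arXiv:2604.26190 — 10 statements merged into one kernel-verified Lean document; each statement's English description precedes it below -/
import Mathlib

section
/- For every string s over an alphabet Σ, applying the Flashback reconstruction to the Flashback decomposition of s recovers s exactly: F⁻¹(F(s)) = s. -/
/-- The alphabet `α` extended with two sentinel symbols `@` and `$`. -/
abbrev Symb (α : Type*) := α ⊕ Bool

/-- The sentinel `@`. -/
def atSym {α : Type*} : Symb α := Sum.inr false

/-- The sentinel `$`. -/
def dollarSym {α : Type*} : Symb α := Sum.inr true

instance {α : Type*} : Inhabited (Symb α) := ⟨atSym⟩

/-- A bilateral token: a symbol string together with a split position. -/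
structure Tok (β : Type*) where
  sym : List β
  split : ℕ
  deriving DecidableEq

instance {β : Type*} : Inhabited (Tok β) := ⟨⟨[], 0⟩⟩

/-- Fuel-based bilateral peeling.  On a nonempty span: if the span is a single
maximal run, emit the terminal token `(span, 0)`; otherwise remove the maximal
leading run and the maximal trailing run, emit the token whose symbol string is
the leading run concatenated with the trailing run (split = leading-run length,
or split 0 and stop if nothing remains in the middle), and recurse on the
middle.  Any fuel `≥` the span length suffices. -/
def peelF {β : Type*} [DecidableEq β] : ℕ → List β → List (Tok β)
  | 0, _ => []
  | _ + 1, [] => []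
  | fuel + 1, a :: t =>
    let w := a :: t
    let front := w.takeWhile (fun x => decide (x = a))
    let rest := w.dropWhile (fun x => decide (x = a))
    if rest.isEmpty then [⟨w, 0⟩]
    else
      let z := w.getLastD a
      let back := (w.reverse.takeWhile (fun x => decide (x = z))).reverse
      let mid := rest.take (rest.length - back.length)
      if mid.isEmpty then [⟨front ++ back, 0⟩]
      else ⟨front ++ back, front.length⟩ :: peelF fuel mid

/-- The sentinel-wrapped form `ŝ = @ · s · $`. -/
def wrap {α : Type*} (s : List α) : List (Symb α) :=
  atSym :: s.map Sum.inl ++ [dollarSym]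

/-- The Flashback decomposition `F(s)`. -/
def flashback {α : Type*} [DecidableEq α] (s : List α) : List (Tok (Symb α)) :=
  peelF (wrap s).length (wrap s)

/-- Inside-out nesting of a token sequence: the innermost symbol string is
returned verbatim, and each earlier token contributes `front ‖ inner ‖ back`. -/
def nestTok {β : Type*} : List (Tok β) → List β
  | [] => []
  | [τ] => τ.sym
  | τ :: rest => τ.sym.take τ.split ++ nestTok rest ++ τ.sym.drop τ.split

/-- The Flashback reconstruction `F⁻¹(T)`: nest the tokens and strip the two
sentinels. -/
def reconstruct {α : Type*} (T : List (Tok (Symb α))) : List α :=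
  (((nestTok T).drop 1).dropLast).filterMap Sum.getLeft?

/-- The number of maximal runs of a string. -/
def runCount {α : Type*} [DecidableEq α] : List α → ℕ
  | [] => 0
  | [_] => 1
  | a :: b :: t => (if a = b then 0 else 1) + runCount (b :: t)

/-- Length of the maximal leading run. -/
def leadRunLen {α : Type*} [DecidableEq α] : List α → ℕ
  | [] => 0
  | a :: t => (t.takeWhile (fun x => decide (x = a))).length + 1

/-- Length of the maximal trailing run. -/
def trailRunLen {α : Type*} [DecidableEq α] (w : List α) : ℕ :=
  leadRunLen w.reverse

theorem List.takeWhile_reverse_append_eq {β : Type*} [DecidableEq β] {a z : β}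
    {front rest : List β} (hfront : ∀ x ∈ front, x = a) (hrest : ∃ x ∈ rest, x ≠ a) :
    (front ++ rest).reverse.takeWhile (fun x => decide (x = z)) =
      rest.reverse.takeWhile (fun x => decide (x = z)) := by
  rw [List.reverse_append, List.takeWhile_append]
  split_ifs with h
  · have hall : ∀ x ∈ rest, x = z := by
      have h' := (List.takeWhile_prefix (fun x => decide (x = z))).eq_of_length h
      simpa [List.takeWhile_eq_self_iff] using h'
    obtain ⟨y, hy, hya⟩ := hrest
    have hnil : front.reverse.takeWhile (fun x => decide (x = z)) = [] := by
      refine List.eq_nil_iff_forall_not_mem.2 fun x hx => ?_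
      have hxz : x = z := by simpa using List.mem_takeWhile_imp hx
      have hxa := hfront x (by simpa using (List.takeWhile_prefix _).subset hx)
      exact hya ((hall y hy).trans (hxz.symm.trans hxa))
    rw [hnil, List.append_nil]
    exact ((List.takeWhile_prefix (fun x => decide (x = z))).eq_of_length h).symm
  · rfl

theorem List.IsSuffix.take_length_sub_append {β : Type*} {back l : List β} (h : back <:+ l) :
    l.take (l.length - back.length) ++ back = l := by
  obtain ⟨t, rfl⟩ := h
  simp

theorem nestTok_cons {β : Type*} (τ : Tok β) {T : List (Tok β)} (hT : T ≠ []) :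
    nestTok (τ :: T) = τ.sym.take τ.split ++ nestTok T ++ τ.sym.drop τ.split := by
  cases T with
  | nil => exact absurd rfl hT
  | cons _ _ => rfl

theorem peelF_ne_nil {β : Type*} [DecidableEq β] {n : ℕ} {w : List β} (hw : w ≠ [])
    (hn : w.length ≤ n) : peelF n w ≠ [] := by
  cases w with
  | nil => exact absurd rfl hw
  | cons a t =>
    cases n with
    | zero => simp at hn
    | succ n =>
      simp only [peelF]
      split_ifs <;> simp

/-- Nesting the peeled tokens of a span gives the span back. -/
theorem nestTok_peelF {β : Type*} [DecidableEq β] (n : ℕ) (w : List β) (hn : w.length ≤ n) :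
    nestTok (peelF n w) = w := by
  induction n generalizing w with
  | zero => simp_all [peelF, nestTok]
  | succ n ih =>
    cases w with
    | nil => rfl
    | cons a t =>
      simp only [peelF]
      split_ifs with hrest hmid
      · rfl
      all_goals
        generalize hz : (a :: t).getLastD a = z at *
        have hw := List.takeWhile_append_dropWhile (p := fun x => decide (x = a)) (l := a :: t)
        have hfront : ∀ x ∈ (a :: t).takeWhile (fun x => decide (x = a)), x = a := fun x hx => by
          simpa using List.mem_takeWhile_imp hx
        have hpos : 0 < ((a :: t).takeWhile (fun x => decide (x = a))).length := by simp
        have hex : ∃ x ∈ (a :: t).dropWhile (fun x => decide (x = a)), x ≠ a := by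
          have hne : (a :: t).dropWhile (fun x => decide (x = a)) ≠ [] := by simpa using hrest
          exact ⟨_, List.head_mem hne, by
            simpa using List.head_dropWhile_not (fun x => decide (x = a)) hne⟩
        generalize (a :: t).takeWhile (fun x => decide (x = a)) = front at *
        generalize (a :: t).dropWhile (fun x => decide (x = a)) = rest at *
        have hback := List.takeWhile_reverse_append_eq (z := z) hfront hex
        rw [hw] at hback
        rw [hback] at hmid ⊢
        have hsuf : (rest.reverse.takeWhile (fun x => decide (x = z))).reverse <:+ rest := by
          simpa using List.reverse_suffix.2
            (List.takeWhile_prefix (fun x => decide (x = z)) (l := rest.reverse))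
        have hsplit := hsuf.take_length_sub_append
        generalize (rest.reverse.takeWhile (fun x => decide (x = z))).reverse = back at *
        generalize rest.take (rest.length - back.length) = mid at *
      · rw [List.isEmpty_iff.1 hmid, List.nil_append] at hsplit
        rw [hsplit]
        exact hw
      · have hlen : mid.length ≤ n := by
          have h₁ := congrArg List.length hw
          have h₂ := congrArg List.length hsplit
          simp only [List.length_append] at h₁ h₂
          omega
        rw [nestTok_cons _ (peelF_ne_nil (by simpa using hmid) hlen), ih mid hlen]
        simp only [List.take_left, List.drop_left]
        rw [List.append_assoc, hsplit, hw]

/-- **Reversibility.**  For every string `s` over the alphabet `α`,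
`F⁻¹(F(s)) = s`. -/
theorem flashback_reversibility {α : Type*} [DecidableEq α] (s : List α) :
    reconstruct (flashback s) = s := by
  rw [reconstruct, flashback, nestTok_peelF _ _ le_rfl]
  simp [wrap, List.filterMap_map, Function.comp_def]
end

section
/- For every string s of length n, the symbol strings of the tokens of the Flashback decomposition F(s) form a multiset partition of the characters of the sentinel-wrapped string ŝ = @·s·$; in particular the sum of the lengths of the token symbol strings equals n + 2. -/
theorem List.take_length_sub_append_of_suffix {β : Type*} {b l : List β} (h : b <:+ l) :
    l.take (l.length - b.length) ++ b = l := by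
  obtain ⟨t, rfl⟩ := h
  simp

/-- If `w` is not a single run, its trailing run avoids its leading run. -/
theorem reverse_takeWhile_reverse_suffix_dropWhile {β : Type*} [DecidableEq β] (a z : β)
    (w : List β) (h : w.dropWhile (fun x => decide (x = a)) ≠ []) :
    (w.reverse.takeWhile (fun x => decide (x = z))).reverse <:+
      w.dropWhile (fun x => decide (x = a)) := by
  set front := w.takeWhile (fun x => decide (x = a))
  set rest := w.dropWhile (fun x => decide (x = a))
  have hw : w = front ++ rest := List.takeWhile_append_dropWhile.symm
  have hfa : ∀ x ∈ front, x = a := fun x hx => by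
    simpa using List.mem_takeWhile_imp hx
  have hhead : rest.head h ≠ a := by
    simpa using List.head_dropWhile_not (fun x => decide (x = a)) h
  rw [hw, List.reverse_append, List.takeWhile_append]
  split_ifs with hlen
  · have hall : rest.reverse.takeWhile (fun x => decide (x = z)) = rest.reverse :=
      (List.takeWhile_sublist _).eq_of_length hlen
    have hz : rest.head h = z := by
      have := List.takeWhile_eq_self_iff.mp hall (rest.head h) (by simp)
      simpa using this
    have hnil : front.reverse.takeWhile (fun x => decide (x = z)) = [] := by
      rw [List.eq_nil_iff_forall_not_mem]
      intro x hx
      have hxz : x = z := by simpa using List.mem_takeWhile_imp hx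
      have hxa := hfa x (List.mem_reverse.mp ((List.takeWhile_sublist _).subset hx))
      exact hhead (hz.trans (hxz.symm.trans hxa))
    simp [hnil]
  · simpa using List.reverse_suffix.mpr
      (⟨_, List.takeWhile_append_dropWhile⟩ :
        rest.reverse.takeWhile (fun x => decide (x = z)) <+: rest.reverse)

theorem peelF_flatMap_sym_perm {β : Type*} [DecidableEq β] (fuel : ℕ) (w : List β)
    (hw : w.length ≤ fuel) : ((peelF fuel w).flatMap Tok.sym).Perm w := by
  induction fuel generalizing w with
  | zero => simp [peelF, List.length_eq_zero_iff.mp (Nat.le_zero.mp hw)]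
  | succ fuel ih =>
    cases w with
    | nil => simp [peelF]
    | cons a t =>
      have hsplit := List.takeWhile_append_dropWhile
        (p := fun x => decide (x = a)) (l := a :: t)
      have hsuff := reverse_takeWhile_reverse_suffix_dropWhile a ((a :: t).getLastD a) (a :: t)
      have hshort : ((a :: t).dropWhile (fun x => decide (x = a))).length ≤ fuel := by
        have := (List.dropWhile_suffix (l := t) (fun x => decide (x = a))).length_le
        simp only [List.length_cons] at hw
        simp only [List.dropWhile_cons, decide_true, if_true]
        lia
      simp only [peelF]
      generalize (a :: t).takeWhile (fun x => decide (x = a)) = front at *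
      generalize (a :: t).dropWhile (fun x => decide (x = a)) = rest at *
      generalize ((a :: t).reverse.takeWhile
        (fun x => decide (x = (a :: t).getLastD a))).reverse = back at *
      split_ifs with hrest hmid
      · simp
      · have hback := List.take_length_sub_append_of_suffix (hsuff (by simpa using hrest))
        rw [List.isEmpty_iff.mp hmid, List.nil_append] at hback
        simp [hback, hsplit]
      · have hback := List.take_length_sub_append_of_suffix (hsuff (by simpa using hrest))
        have hmid_perm := ih (rest.take (rest.length - back.length))
          ((List.length_take_le' _ _).trans hshort)
        rw [List.flatMap_cons, ← hsplit, List.append_assoc]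
        refine List.Perm.append_left front ?_
        conv_rhs => rw [← hback]
        exact (hmid_perm.append_left back).trans List.perm_append_comm

/-- **Alphabet partition.**  The token symbol strings of `F(s)` form a multiset
partition of the characters of the sentinel-wrapped string `ŝ = @·s·$`; in
particular the sum of the lengths of the token symbol strings is `n + 2`. -/
theorem flashback_alphabet_partition {α : Type*} [DecidableEq α] (s : List α) :
    (↑((flashback s).flatMap Tok.sym) : Multiset (Symb α)) = ↑(wrap s) ∧
    ((flashback s).map fun τ => τ.sym.length).sum = s.length + 2 := by
  have hperm : ((flashback s).flatMap Tok.sym).Perm (wrap s) :=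
    peelF_flatMap_sym_perm _ _ le_rfl
  refine ⟨Multiset.coe_eq_coe.mpr hperm, ?_⟩
  rw [← List.length_flatMap, hperm.length_eq]
  simp [wrap]
end

section
/- For every nonempty string s over Σ, the first token of the Flashback decomposition F(s) is (@$, 1) (the two-character string @$ with split position 1), it is non-terminal, and moreover a terminal token (one with split position 0) can occur only as the last element of the token sequence F(s). -/
theorem eq_length_sub_one_of_split_peelF_eq_zero {β : Type*} [DecidableEq β] (n : ℕ) (w : List β)
    (d : ℕ) (hd : d < (peelF n w).length) (h : ((peelF n w).getD d default).split = 0) :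
    d = (peelF n w).length - 1 := by
  induction n generalizing w d with
  | zero => simp [peelF] at hd
  | succ n ih =>
    cases w with
    | nil => simp [peelF] at hd
    | cons a t =>
      rw [peelF] at hd h ⊢
      dsimp only at hd h ⊢
      split_ifs at hd h ⊢
      · simpa using hd
      · simpa using hd
      · cases d with
        | zero => simp at h
        | succ d =>
          simp only [List.length_cons, List.getD_cons_succ] at hd h ⊢
          have := ih _ d (by omega) h
          omega

theorem headI_flashback {α : Type*} [DecidableEq α] (s : List α) (hs : s ≠ []) :
    (flashback s).headI = ⟨[atSym, dollarSym], 1⟩ := by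
  obtain ⟨b, t, rfl⟩ := List.exists_cons_of_ne_nil hs
  have hback : (List.takeWhile (fun x => decide (x = (dollarSym : Symb α)))
      (wrap (b :: t)).reverse).reverse = [dollarSym] := by
    cases h : (b :: t).reverse with
    | nil => simp at h
    | cons c u =>
      simp [wrap, ← List.map_reverse, atSym, dollarSym, -List.map_cons, h]
  have hlast : (wrap (b :: t)).getLastD atSym = dollarSym := by
    rw [wrap, List.getLastD_eq_getLast?, List.getLast?_append]
    simp
  simp only [wrap, List.cons_append] at hback hlast
  simp only [flashback, wrap, List.cons_append, List.length_cons, peelF, hlast, hback]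
  simp [atSym, dollarSym]

/-- **Sentinel and terminal tokens.**  For nonempty `s`, the first token of
`F(s)` is `(@$, 1)` — in particular non-terminal (split `1 ≠ 0`) — and a
terminal token (split position `0`) can occur only as the last element of
`F(s)`. -/
theorem flashback_sentinel_terminal {α : Type*} [DecidableEq α]
    (s : List α) (hs : s ≠ []) :
    (flashback s).headI = ⟨[atSym, dollarSym], 1⟩ ∧
    ((flashback s).headI).split ≠ 0 ∧
    ∀ d, d < (flashback s).length → ((flashback s).getD d default).split = 0 →
      d = (flashback s).length - 1 := by
  have h := headI_flashback s hs
  refine ⟨h, by simp [h], fun d hd hsplit => ?_⟩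
  exact eq_length_sub_one_of_split_peelF_eq_zero _ _ d hd hsplit
end

section
/- Run-pairing theorem (token count): for every nonempty string s with r maximal runs, the Flashback decomposition F(s) consists of exactly k = 1 + ⌈r/2⌉ tokens. -/
theorem runCount_cons {α : Type*} [DecidableEq α] (a : α) (t : List α) :
    runCount (a :: t) = runCount t + if t.head? = some a then 0 else 1 := by
  cases t with
  | nil => simp [runCount]
  | cons b t => simp [runCount, eq_comm, add_comm]

theorem runCount_concat {α : Type*} [DecidableEq α] (l : List α) (x : α) :
    runCount (l ++ [x]) = runCount l + if l.getLast? = some x then 0 else 1 := by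
  induction l with
  | nil => simp [runCount]
  | cons a t ih =>
    rw [List.cons_append, runCount_cons, runCount_cons, ih]
    cases t with
    | nil => simp [runCount, eq_comm]
    | cons b t => simp [List.getLast?_cons_cons]; omega

theorem runCount_reverse {α : Type*} [DecidableEq α] (l : List α) :
    runCount l.reverse = runCount l := by
  induction l with
  | nil => rfl
  | cons a t ih =>
    rw [List.reverse_cons, runCount_concat, runCount_cons, ih, List.getLast?_reverse]

/-- Removing the maximal leading run lowers the number of runs by one. -/
theorem runCount_eq_dropWhile_add_one {α : Type*} [DecidableEq α] (a : α) (t : List α) :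
    runCount (a :: t) = runCount ((a :: t).dropWhile (fun x => decide (x = a))) + 1 := by
  induction t with
  | nil => simp [runCount]
  | cons b t ih =>
    by_cases h : b = a
    · subst h
      simpa [runCount] using ih
    · simp [runCount, h, Ne.symm h, add_comm]

/-- Removing the maximal trailing run lowers the number of runs by one. -/
theorem runCount_eq_rdropWhile_add_one {α : Type*} [DecidableEq α] (l : List α) (z : α)
    (h : l.getLast? = some z) :
    runCount l = runCount (l.rdropWhile (fun x => decide (x = z))) + 1 := by
  rw [List.rdropWhile, runCount_reverse, ← runCount_reverse l]
  rw [← List.head?_reverse] at h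
  obtain ⟨t, ht⟩ := List.head?_eq_some_iff.mp h
  rw [ht, runCount_eq_dropWhile_add_one]

theorem takeWhile_append_eq_left {β : Type*} (p : β → Bool) (l₁ l₂ : List β)
    (h : (∀ x ∈ l₁, p x = true) → ∀ x ∈ l₂, p x = false) :
    (l₁ ++ l₂).takeWhile p = l₁.takeWhile p := by
  induction l₁ with
  | nil =>
    cases l₂ with
    | nil => rfl
    | cons b l => simp [h]
  | cons a l ih =>
    cases ha : p a with
    | false => simp [ha]
    | true =>
      simp only [List.cons_append, List.takeWhile_cons, ha, if_true]
      rw [ih fun hl => h (by simpa [ha] using hl)]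

theorem take_length_sub_eq_rdropWhile {β : Type*} (p : β → Bool) (l : List β) :
    l.take (l.length - (l.reverse.takeWhile p).length) = l.rdropWhile p := by
  have h : l.rdropWhile p ++ (l.reverse.takeWhile p).reverse = l := by
    rw [List.rdropWhile, ← List.reverse_append, List.takeWhile_append_dropWhile,
      List.reverse_reverse]
  have hlen := congrArg List.length h
  rw [List.length_append, List.length_reverse] at hlen
  have : l.length - (l.reverse.takeWhile p).length = (l.rdropWhile p).length := by omega
  rw [this]
  have htake : (l.rdropWhile p ++ (l.reverse.takeWhile p).reverse).take
      (l.rdropWhile p).length = l.rdropWhile p := by simp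
  rwa [h] at htake

/-- If the span is not a single run, its trailing run is that of the part behind the
leading run. -/
theorem takeWhile_reverse_eq_of_dropWhile {β : Type*} [DecidableEq β] (w : List β) (a z : β)
    (h : w.dropWhile (fun x => decide (x = a)) ≠ []) :
    w.reverse.takeWhile (fun x => decide (x = z)) =
      (w.dropWhile (fun x => decide (x = a))).reverse.takeWhile (fun x => decide (x = z)) := by
  conv_lhs =>
    rw [← List.takeWhile_append_dropWhile (p := fun x => decide (x = a)) (l := w),
      List.reverse_append]
  refine takeWhile_append_eq_left _ _ _ fun hall x hx => ?_
  have hxa : x = a := by simpa using List.mem_takeWhile_imp (List.mem_reverse.mp hx)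
  have hz := hall _ (List.mem_reverse.mpr (List.head_mem h))
  have hne := List.head_dropWhile_not (fun x => decide (x = a)) h
  simp only [decide_eq_true_eq, decide_eq_false_iff_not] at hz hne ⊢
  rw [hxa, ← hz]
  exact Ne.symm hne

/-- Peeling pairs up the runs from the outside in. -/
theorem length_peelF {β : Type*} [DecidableEq β] (fuel : ℕ) (w : List β)
    (hw : w.length ≤ fuel) : (peelF fuel w).length = (runCount w + 1) / 2 := by
  induction fuel generalizing w with
  | zero =>
    obtain rfl : w = [] := by simpa using hw
    simp [peelF, runCount]
  | succ fuel ih =>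
    cases w with
    | nil => simp [peelF, runCount]
    | cons a t =>
      rw [runCount_eq_dropWhile_add_one]
      simp only [peelF]
      set rest := (a :: t).dropWhile (fun x => decide (x = a)) with hrest
      by_cases hr : rest = []
      · simp [hr, runCount]
      · have hsplit : (a :: t).takeWhile (fun x => decide (x = a)) ++ rest = a :: t :=
          List.takeWhile_append_dropWhile
        set z := (a :: t).getLastD a with hz
        have hlast : rest.getLast? = some z := by
          rw [hz, List.getLastD_eq_getLast?, ← hsplit, List.getLast?_append_of_ne_nil _ hr,
            List.getLast?_eq_getLast_of_ne_nil hr]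
          rfl
        have hlen : rest.length ≤ t.length := by
          rw [hrest, List.dropWhile_cons]
          simpa using (List.dropWhile_sublist _).length_le
        rw [takeWhile_reverse_eq_of_dropWhile _ _ _ hr, ← hrest, List.length_reverse,
          take_length_sub_eq_rdropWhile, runCount_eq_rdropWhile_add_one rest z hlast]
        have hmid := (List.rdropWhile_prefix (fun x => decide (x = z)) (l := rest)).length_le
        set mid := rest.rdropWhile (fun x => decide (x = z))
        by_cases hm : mid = []
        · simp [hr, hm, runCount]
        · have hfuel : mid.length ≤ fuel := by
            rw [List.length_cons] at hw
            omega
          simp [hr, hm, ih mid hfuel]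
          omega

theorem runCount_map {α β : Type*} [DecidableEq α] [DecidableEq β] (f : α → β)
    (hf : Function.Injective f) (s : List α) : runCount (s.map f) = runCount s := by
  induction s with
  | nil => rfl
  | cons a t ih =>
    rw [List.map_cons, runCount_cons, runCount_cons, ih]
    cases t <;> simp [hf.eq_iff]

theorem runCount_wrap {α : Type*} [DecidableEq α] (s : List α) (hs : s ≠ []) :
    runCount (wrap s) = runCount s + 2 := by
  rw [wrap, runCount_concat, runCount_cons, runCount_map _ Sum.inl_injective]
  obtain ⟨a, t, rfl⟩ := List.exists_cons_of_ne_nil hs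
  have hlast : (atSym :: (a :: t).map Sum.inl).getLast? ≠ some (dollarSym : Symb α) := by
    rw [List.map_cons, List.getLast?_cons_cons, ← List.map_cons, List.getLast?_map]
    simp [dollarSym]
  rw [if_neg hlast]
  simp [atSym]

/-- **Run-pairing theorem (token count).**  For every nonempty string `s` with
`r` maximal runs, the Flashback decomposition `F(s)` consists of exactly
`k = 1 + ⌈r/2⌉` tokens. -/
theorem flashback_token_count {α : Type*} [DecidableEq α]
    (s : List α) (hs : s ≠ []) :
    (flashback s).length = 1 + (runCount s + 1) / 2 := by
  rw [flashback, length_peelF _ _ le_rfl, runCount_wrap s hs]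
  omega
end

section
/- Run-pairing theorem (token structure): let s be a nonempty string with run-length encoding s = a₁^{m₁} ⋯ a_r^{m_r} and set h = ⌈r/2⌉. Then in F(s) = [τ₀, …, τ_k−1] with k = 1 + h: the sentinel token is τ₀ = (@$, 1); for 1 ≤ j ≤ h − 1 the content token τ_j pairs the j-th run from the left with the j-th run from the right, τ_j = (a_j^{m_j} · a_{r+1−j}^{m_{r+1−j}}, m_j); and the terminal token is τ_{k−1} = (a_h^{m_h}, 0) if r is odd, and τ_{k−1} = (a_h^{m_h} · a_{h+1}^{m_{h+1}}, 0) if r is even. -/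
/-- Expansion of a run-length encoding given by 1-indexed run symbols `a i`
and run multiplicities `m i`, with `r` runs:
`a 1 ^ m 1 ++ a 2 ^ m 2 ++ ⋯ ++ a r ^ m r`. -/
def rleOfFun {α : Type*} (a : ℕ → α) (m : ℕ → ℕ) (r : ℕ) : List α :=
  (List.range r).flatMap fun i => List.replicate (m (i + 1)) (a (i + 1))

theorem takeWhile_replicate_append {β : Type*} [DecidableEq β] (p : ℕ) (x : β) (w : List β)
    (h : ∀ y ∈ w.head?, y ≠ x) :
    (List.replicate p x ++ w).takeWhile (fun y => decide (y = x)) = List.replicate p x := by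
  induction p with
  | zero => cases w <;> simp_all
  | succ p ih => simp [List.replicate_succ, ih]

theorem dropWhile_replicate_append {β : Type*} [DecidableEq β] (p : ℕ) (x : β) (w : List β)
    (h : ∀ y ∈ w.head?, y ≠ x) :
    (List.replicate p x ++ w).dropWhile (fun y => decide (y = x)) = w := by
  induction p with
  | zero => cases w <;> simp_all
  | succ p ih => simp [List.replicate_succ, ih]

theorem peelF_replicate {β : Type*} [DecidableEq β] (f p : ℕ) (x : β) (hp : 1 ≤ p) :
    peelF (f + 1) (List.replicate p x) = [⟨List.replicate p x, 0⟩] := by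
  obtain ⟨p, rfl⟩ := Nat.exists_eq_add_of_le' hp
  simp [List.replicate_succ, peelF]

/-- One peeling step on a span whose outer maximal runs are `x ^ p` and `z ^ q`. -/
theorem peelF_replicate_append {β : Type*} [DecidableEq β] (f p q : ℕ) (x z : β) (w : List β)
    (hp : 1 ≤ p) (hq : 1 ≤ q)
    (hx : ∀ y ∈ (w ++ List.replicate q z).head?, y ≠ x)
    (hz : ∀ y ∈ (List.replicate p x ++ w).getLast?, y ≠ z) :
    peelF (f + 1) (List.replicate p x ++ (w ++ List.replicate q z)) =
      if w.isEmpty then [⟨List.replicate p x ++ List.replicate q z, 0⟩]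
      else ⟨List.replicate p x ++ List.replicate q z, p⟩ :: peelF f w := by
  have htake := takeWhile_replicate_append p x _ hx
  have hdrop := dropWhile_replicate_append p x _ hx
  have hback := takeWhile_replicate_append q z (List.replicate p x ++ w).reverse
    (by simpa only [List.head?_reverse] using hz)
  have hrev : (List.replicate p x ++ (w ++ List.replicate q z)).reverse =
      List.replicate q z ++ (List.replicate p x ++ w).reverse := by simp
  have hlast : (List.replicate p x ++ (w ++ List.replicate q z)).getLastD x = z := by
    obtain ⟨q, rfl⟩ := Nat.exists_eq_add_of_le' hq
    simp [List.replicate_succ', ← List.append_assoc]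
  obtain ⟨t, ht⟩ : ∃ t, List.replicate p x ++ (w ++ List.replicate q z) = x :: t := by
    obtain ⟨p, rfl⟩ := Nat.exists_eq_add_of_le' hp
    exact ⟨_, by rw [List.replicate_succ, List.cons_append]⟩
  rw [← hrev] at hback
  rw [ht] at htake hdrop hback hlast ⊢
  have hne : (w ++ List.replicate q z).isEmpty = false := by
    simp; omega
  simp only [peelF, htake, hdrop, hlast, hback, hne]
  simp

/-- The concatenation of the `n` runs `a i ^ m i`, …, `a (i + n - 1) ^ m (i + n - 1)`. -/
def runSegment {β : Type*} (a : ℕ → β) (m : ℕ → ℕ) (i n : ℕ) : List β :=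
  (List.range' i n).flatMap fun k => List.replicate (m k) (a k)

theorem runSegment_succ {β : Type*} (a : ℕ → β) (m : ℕ → ℕ) (i n : ℕ) :
    runSegment a m i (n + 1) = List.replicate (m i) (a i) ++ runSegment a m (i + 1) n := by
  simp [runSegment, List.range'_succ]

theorem runSegment_succ_last {β : Type*} (a : ℕ → β) (m : ℕ → ℕ) (i n : ℕ) :
    runSegment a m i (n + 1) =
      runSegment a m i n ++ List.replicate (m (i + n)) (a (i + n)) := by
  simp [runSegment, List.range'_concat]

theorem head?_runSegment_succ {β : Type*} (a : ℕ → β) (m : ℕ → ℕ) (i n : ℕ) (h : 1 ≤ m i) :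
    (runSegment a m i (n + 1)).head? = some (a i) := by
  rw [runSegment_succ]
  simp [List.head?_replicate, Nat.ne_of_gt h]

theorem getLast?_runSegment_succ {β : Type*} (a : ℕ → β) (m : ℕ → ℕ) (i n : ℕ)
    (h : 1 ≤ m (i + n)) : (runSegment a m i (n + 1)).getLast? = some (a (i + n)) := by
  rw [runSegment_succ_last]
  simp [List.getLast?_append, List.getLast?_replicate, Nat.ne_of_gt h]

/-- The `j`-th token in the decomposition of `runSegment a m i n`. -/
def segmentToken {β : Type*} (a : ℕ → β) (m : ℕ → ℕ) (i n j : ℕ) : Tok β :=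
  if 2 * j + 1 = n then ⟨List.replicate (m (i + j)) (a (i + j)), 0⟩
  else ⟨List.replicate (m (i + j)) (a (i + j)) ++
      List.replicate (m (i + n - 1 - j)) (a (i + n - 1 - j)),
    if 2 * j + 2 = n then 0 else m (i + j)⟩

theorem segmentToken_succ {β : Type*} (a : ℕ → β) (m : ℕ → ℕ) (i n j : ℕ) :
    segmentToken a m i (n + 2) (j + 1) = segmentToken a m (i + 1) n j := by
  have h₁ : i + (j + 1) = i + 1 + j := by omega
  have h₂ : i + (n + 2) - 1 - (j + 1) = i + 1 + n - 1 - j := by omega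
  have h₃ : 2 * (j + 1) + 1 = n + 2 ↔ 2 * j + 1 = n := by omega
  have h₄ : 2 * (j + 1) + 2 = n + 2 ↔ 2 * j + 2 = n := by omega
  simp only [segmentToken, h₁, h₂, h₃, h₄]

theorem peelF_runSegment {β : Type*} [DecidableEq β] (a : ℕ → β) (m : ℕ → ℕ) (n i f : ℕ)
    (hm : ∀ k, i ≤ k → k < i + n → 1 ≤ m k)
    (ha : ∀ k, i ≤ k → k + 1 < i + n → a k ≠ a (k + 1)) (hf : n ≤ f) :
    peelF f (runSegment a m i n) =
      (List.range ((n + 1) / 2)).map (segmentToken a m i n) := by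
  induction n using Nat.strong_induction_on generalizing i f with
  | _ n ih =>
    match n, f, hf with
    | 0, 0, _ => simp [peelF]
    | 0, f + 1, _ => simp [runSegment, peelF]
    | 1, f + 1, _ =>
      rw [show runSegment a m i 1 = List.replicate (m i) (a i) by simp [runSegment],
        peelF_replicate _ _ _ (hm i le_rfl (by omega))]
      simp [segmentToken]
    | n + 2, f + 1, hf =>
      have hlast : runSegment a m (i + 1) (n + 1) = runSegment a m (i + 1) n ++
          List.replicate (m (i + 1 + n)) (a (i + 1 + n)) := runSegment_succ_last ..
      have hx : ∀ y ∈ (runSegment a m (i + 1) (n + 1)).head?, y ≠ a i := by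
        rw [head?_runSegment_succ _ _ _ _ (hm _ (by omega) (by omega))]
        rintro y ⟨⟩
        exact (ha i le_rfl (by omega)).symm
      have hz : ∀ y ∈ (runSegment a m i (n + 1)).getLast?, y ≠ a (i + 1 + n) := by
        rw [getLast?_runSegment_succ _ _ _ _ (hm _ (by omega) (by omega))]
        rintro y ⟨⟩
        rw [Nat.add_right_comm]
        exact ha (i + n) (by omega) (by omega)
      rw [hlast] at hx
      rw [runSegment_succ] at hz
      rw [runSegment_succ, hlast, peelF_replicate_append _ _ _ _ _ _
        (hm i le_rfl (by omega)) (hm _ (by omega) (by omega)) hx hz]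
      rw [show (n + 2 + 1) / 2 = (n + 1) / 2 + 1 by omega, List.range_succ_eq_map,
        List.map_cons, List.map_map]
      have htail : segmentToken a m i (n + 2) ∘ Nat.succ = segmentToken a m (i + 1) n :=
        funext fun j => segmentToken_succ a m i n j
      have hidx : i + (n + 2) - 1 - 0 = i + 1 + n := by omega
      rw [htail, ← ih n (by omega) (i + 1) f (fun k _ _ => hm k (by omega) (by omega))
        (fun k _ _ => ha k (by omega) (by omega)) (by omega)]
      rcases n with _ | n
      · cases f <;> simp [runSegment, segmentToken, peelF]
      · have hne : (runSegment a m (i + 1) (n + 1)).isEmpty = false := by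
          have := head?_runSegment_succ a m (i + 1) n (hm _ (by omega) (by omega))
          cases h : runSegment a m (i + 1) (n + 1) <;> simp_all
        simp only [hne, segmentToken, hidx]
        simp

/-- The run symbols of the sentinel-wrapped string with `r` inner runs. -/
def wrapSym {α : Type*} (a : ℕ → α) (r k : ℕ) : Symb α :=
  if k = 0 then atSym else if k = r + 1 then dollarSym else Sum.inl (a k)

/-- The run multiplicities of the sentinel-wrapped string with `r` inner runs. -/
def wrapMult (m : ℕ → ℕ) (r k : ℕ) : ℕ :=
  if k = 0 then 1 else if k = r + 1 then 1 else m k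

theorem wrap_rleOfFun {α : Type*} (a : ℕ → α) (m : ℕ → ℕ) (r : ℕ) :
    wrap (rleOfFun a m r) = runSegment (wrapSym a r) (wrapMult m r) 0 (r + 2) := by
  have hmid : (rleOfFun a m r).map Sum.inl =
      runSegment (wrapSym a r) (wrapMult m r) 1 r := by
    rw [runSegment, rleOfFun, List.map_flatMap, List.range'_eq_map_range, List.flatMap_map]
    refine List.flatMap_congr fun k hk => ?_
    have := List.mem_range.mp hk
    have h₁ : k + 1 ≠ r + 1 := by omega
    simp [wrapSym, wrapMult, Nat.add_comm 1 k, this.ne]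
  rw [runSegment_succ, runSegment_succ_last, wrap, hmid]
  simp [wrapSym, wrapMult, Nat.add_comm 1 r]

theorem flashback_rleOfFun {α : Type*} [DecidableEq α] (a : ℕ → α) (m : ℕ → ℕ) (r : ℕ)
    (hr : 1 ≤ r) (hm : ∀ i, 1 ≤ i → i ≤ r → 1 ≤ m i)
    (ha : ∀ i, 1 ≤ i → i < r → a i ≠ a (i + 1)) :
    flashback (rleOfFun a m r) = (List.range (1 + (r + 1) / 2)).map
      (segmentToken (wrapSym a r) (wrapMult m r) 0 (r + 2)) := by
  have hlen : r ≤ (rleOfFun a m r).length := by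
    rw [rleOfFun, List.length_flatMap]
    calc r = ((List.range r).map fun _ => 1).sum := by simp
      _ ≤ _ := List.sum_le_sum fun i hi => by
        have := List.mem_range.mp hi
        simpa using hm (i + 1) i.succ_pos this
  rw [flashback, wrap_rleOfFun, peelF_runSegment]
  · congr 2
    omega
  · intro k _ hk
    unfold wrapMult
    split_ifs <;> first | exact le_rfl | exact hm k (by omega) (by omega)
  · intro k _ hk
    rcases k with _ | k
    · rw [wrapSym, wrapSym, if_pos rfl, if_neg (by omega), if_neg (by omega)]
      simp [atSym]
    · rw [wrapSym, wrapSym, if_neg (by omega), if_neg (by omega), if_neg (by omega)]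
      split_ifs
      · simp [dollarSym]
      · exact fun h => ha (k + 1) (by omega) (by omega) (Sum.inl_injective h)
  · rw [← wrap_rleOfFun]
    simp only [wrap, List.length_append, List.length_cons, List.length_map]
    omega

/-- **Run-pairing theorem (token structure).**  Let `s` be a nonempty string
with run-length encoding `s = a₁^{m₁} ⋯ a_r^{m_r}` and set `h = ⌈r/2⌉`,
`k = 1 + h`.  Then `F(s) = [τ₀, …, τ_{k-1}]` where: the sentinel token is
`τ₀ = (@$, 1)`; for `1 ≤ j ≤ h - 1` the content token is
`τ_j = (a_j^{m_j} · a_{r+1-j}^{m_{r+1-j}}, m_j)`; and the terminal token is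
`τ_{k-1} = (a_h^{m_h}, 0)` if `r` is odd and
`τ_{k-1} = (a_h^{m_h} · a_{h+1}^{m_{h+1}}, 0)` if `r` is even. -/
theorem flashback_run_pairing {α : Type*} [DecidableEq α]
    (a : ℕ → α) (m : ℕ → ℕ) (r : ℕ) (hr : 1 ≤ r)
    (hm : ∀ i, 1 ≤ i → i ≤ r → 1 ≤ m i)
    (ha : ∀ i, 1 ≤ i → i < r → a i ≠ a (i + 1))
    (s : List α) (hs : s = rleOfFun a m r) :
    (flashback s).length = 1 + (r + 1) / 2 ∧
    (flashback s).getD 0 default = ⟨[atSym, dollarSym], 1⟩ ∧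
    (∀ j, 1 ≤ j → j ≤ (r + 1) / 2 - 1 →
      (flashback s).getD j default =
        ⟨(List.replicate (m j) (a j) ++
            List.replicate (m (r + 1 - j)) (a (r + 1 - j))).map Sum.inl,
          m j⟩) ∧
    (r % 2 = 1 →
      (flashback s).getD ((r + 1) / 2) default =
        ⟨(List.replicate (m ((r + 1) / 2)) (a ((r + 1) / 2))).map Sum.inl, 0⟩) ∧
    (r % 2 = 0 →
      (flashback s).getD ((r + 1) / 2) default =
        ⟨(List.replicate (m ((r + 1) / 2)) (a ((r + 1) / 2)) ++
            List.replicate (m ((r + 1) / 2 + 1)) (a ((r + 1) / 2 + 1))).map Sum.inl,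
          0⟩) := by
  subst hs
  rw [flashback_rleOfFun a m r hr hm ha]
  have hget : ∀ j, j < 1 + (r + 1) / 2 →
      ((List.range (1 + (r + 1) / 2)).map
        (segmentToken (wrapSym a r) (wrapMult m r) 0 (r + 2))).getD j default =
      segmentToken (wrapSym a r) (wrapMult m r) 0 (r + 2) j := by
    intro j hj
    simp [List.getD_eq_getElem?_getD, hj]
  have hsym : ∀ k, 1 ≤ k → k ≤ r → wrapSym a r k = Sum.inl (a k) := fun k h₁ h₂ => by
    rw [wrapSym, if_neg (by omega), if_neg (by omega)]
  have hmult : ∀ k, 1 ≤ k → k ≤ r → wrapMult m r k = m k := fun k h₁ h₂ => by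
    rw [wrapMult, if_neg (by omega), if_neg (by omega)]
  refine ⟨by simp, ?_, fun j hj₁ hj₂ => ?_, fun hodd => ?_, fun heven => ?_⟩
  · rw [hget 0 (by omega), segmentToken, if_neg (by omega), if_neg (by omega)]
    simp [wrapSym, wrapMult]
  · rw [hget j (by omega), segmentToken, if_neg (by omega), if_neg (by omega),
      show 0 + (r + 2) - 1 - j = r + 1 - j by omega, Nat.zero_add,
      hsym j (by omega) (by omega), hmult j (by omega) (by omega),
      hsym (r + 1 - j) (by omega) (by omega), hmult (r + 1 - j) (by omega) (by omega)]
    simp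
  · rw [hget _ (by omega), segmentToken, if_pos (by omega), Nat.zero_add,
      hsym _ (by omega) (by omega), hmult _ (by omega) (by omega)]
    simp
  · rw [hget _ (by omega), segmentToken, if_neg (by omega), if_pos (by omega),
      show 0 + (r + 2) - 1 - (r + 1) / 2 = (r + 1) / 2 + 1 by omega, Nat.zero_add,
      hsym _ (by omega) (by omega), hmult _ (by omega) (by omega),
      hsym _ (by omega) (by omega), hmult _ (by omega) (by omega)]
    simp
end

section
/- Expected token count: let s be a random string of length n ≥ 2 with each character drawn i.i.d. uniformly from an alphabet of size σ ≥ 2, and set p = (σ−1)/σ. Then r(s) − 1 is distributed as Binomial(n−1, p), and the expected number of tokens of the Flashback decomposition satisfies E[k] = 1 + (1 + (n−1)p)/2 + (1 + ((2−σ)/σ)^{n−1})/4. -/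
/-- Splitting a sum over strings of length `m + 1` according to the first symbol. -/
theorem sum_fin_succ_pi_eq_sum_cons {σ m : ℕ} (g : List (Fin σ) → ℝ) :
    ∑ s : Fin (m + 1) → Fin σ, g (List.ofFn s) =
      ∑ b : Fin σ, ∑ s : Fin m → Fin σ, g (b :: List.ofFn s) := by
  rw [← (Fin.consEquiv fun _ => Fin σ).sum_comp, Fintype.sum_prod_type]
  simp [Fin.consEquiv, List.ofFn_succ]

/-- The run count of a string with a prescribed first symbol, summed over all continuations
through an arbitrary function `f`. -/
theorem sum_runCount_cons {σ : ℕ} (m : ℕ) (a : Fin σ) (f : ℕ → ℝ) :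
    ∑ s : Fin m → Fin σ, f (runCount (a :: List.ofFn s)) =
      ∑ k ∈ Finset.range (m + 1), (m.choose k : ℝ) * (((σ : ℝ) - 1) ^ k * f (k + 1)) := by
  induction m generalizing a f with
  | zero => simp [runCount]
  | succ m ih =>
    rw [sum_fin_succ_pi_eq_sum_cons fun l => f (runCount (a :: l))]
    simp only [runCount]
    rw [← Finset.add_sum_erase _ _ (Finset.mem_univ a)]
    have hne : ∀ b ∈ Finset.univ.erase a,
        ∑ s : Fin m → Fin σ, f ((if a = b then 0 else 1) + runCount (b :: List.ofFn s)) =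
          ∑ k ∈ Finset.range (m + 1),
            (m.choose k : ℝ) * (((σ : ℝ) - 1) ^ k * f (1 + (k + 1))) := by
      intro b hb
      simp only [if_neg (Finset.ne_of_mem_erase hb).symm]
      exact ih b fun r => f (1 + r)
    have hcard : (((Finset.univ.erase a).card : ℕ) : ℝ) = (σ : ℝ) - 1 := by
      rw [Finset.card_erase_of_mem (Finset.mem_univ a), Finset.card_univ, Fintype.card_fin,
        Nat.cast_pred a.pos]
    rw [Finset.sum_congr rfl hne, Finset.sum_const, nsmul_eq_mul, hcard]
    simp only [if_true, zero_add]
    rw [ih a f, Finset.sum_choose_succ_mul (fun k _ => ((σ : ℝ) - 1) ^ k * f (k + 1)),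
      Finset.mul_sum]
    congr 1
    refine Finset.sum_congr rfl fun k _ => ?_
    rw [add_comm 1 (k + 1)]
    ring

theorem sum_runCount_ofFn {σ : ℕ} (m : ℕ) (f : ℕ → ℝ) :
    ∑ s : Fin (m + 1) → Fin σ, f (runCount (List.ofFn s)) =
      σ * ∑ k ∈ Finset.range (m + 1), (m.choose k : ℝ) * (((σ : ℝ) - 1) ^ k * f (k + 1)) := by
  rw [sum_fin_succ_pi_eq_sum_cons fun l => f (runCount l)]
  simp [sum_runCount_cons]

theorem sum_choose_mul_pow (m : ℕ) (x : ℝ) :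
    ∑ k ∈ Finset.range (m + 1), (m.choose k : ℝ) * x ^ k = (x + 1) ^ m := by
  rw [add_pow]
  exact Finset.sum_congr rfl fun k _ => by ring

theorem sum_choose_mul_pow_mul_id (m : ℕ) (x : ℝ) :
    (x + 1) * ∑ k ∈ Finset.range (m + 1), (m.choose k : ℝ) * (x ^ k * k) =
      m * x * (x + 1) ^ m := by
  induction m with
  | zero => simp
  | succ m ih =>
    rw [Finset.sum_choose_succ_mul (fun k _ => x ^ k * (k : ℝ))]
    have h : ∑ k ∈ Finset.range (m + 1), (m.choose k : ℝ) * (x ^ (k + 1) * ((k + 1 : ℕ) : ℝ)) =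
        x * ∑ k ∈ Finset.range (m + 1), (m.choose k : ℝ) * (x ^ k * k) + x * (x + 1) ^ m := by
      rw [← sum_choose_mul_pow, Finset.mul_sum, Finset.mul_sum, ← Finset.sum_add_distrib]
      refine Finset.sum_congr rfl fun k _ => ?_
      push_cast
      ring
    rw [h]
    push_cast
    linear_combination (x + 1) * ih

theorem cast_one_add_succ_div_two (r : ℕ) :
    ((1 + (r + 1) / 2 : ℕ) : ℝ) = 1 + (r : ℝ) / 2 + (1 - (-1) ^ r) / 4 := by
  rcases Nat.even_or_odd' r with ⟨c, rfl | rfl⟩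
  · rw [show (2 * c + 1) / 2 = c by omega, pow_mul]
    push_cast
    norm_num
  · rw [show (2 * c + 1 + 1) / 2 = c + 1 by omega, pow_succ, pow_mul]
    push_cast
    norm_num
    ring

/-- **Expected token count.**  Let `s` be a uniformly random string of length
`n ≥ 2` over an alphabet of size `σ ≥ 2` and set `p = (σ-1)/σ`.  Then
`r(s) - 1` is distributed as `Binomial(n-1, p)`, and the expected number of
tokens `k = 1 + ⌈r(s)/2⌉` of the Flashback decomposition satisfies
`E[k] = 1 + (1 + (n-1)p)/2 + (1 + ((2-σ)/σ)^{n-1})/4`. -/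
theorem flashback_expected_token_count (n σa : ℕ) (hn : 2 ≤ n) (hσ : 2 ≤ σa) :
    (∀ j : ℕ,
      (Fintype.card {s : Fin n → Fin σa // runCount (List.ofFn s) - 1 = j} : ℝ)
          / (σa : ℝ) ^ n =
        ((n - 1).choose j : ℝ) * (((σa : ℝ) - 1) / σa) ^ j *
          (1 - ((σa : ℝ) - 1) / σa) ^ (n - 1 - j)) ∧
    (∑ s : Fin n → Fin σa,
        ((1 + (runCount (List.ofFn s) + 1) / 2 : ℕ) : ℝ)) / (σa : ℝ) ^ n =
      1 + (1 + ((n : ℝ) - 1) * (((σa : ℝ) - 1) / σa)) / 2 +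
        (1 + ((2 - (σa : ℝ)) / σa) ^ (n - 1)) / 4 := by
  obtain ⟨m, rfl⟩ : ∃ m, n = m + 1 := ⟨n - 1, by omega⟩
  have hσ0 : (σa : ℝ) ≠ 0 := by
    have : σa ≠ 0 := by omega
    exact_mod_cast this
  simp only [Nat.add_sub_cancel]
  constructor
  · intro j
    have hcard : (Fintype.card {s : Fin (m + 1) → Fin σa // runCount (List.ofFn s) - 1 = j} : ℝ) =
        σa * ((m.choose j : ℝ) * ((σa : ℝ) - 1) ^ j) := by
      have h := sum_runCount_ofFn (σ := σa) m fun r => if r - 1 = j then 1 else 0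
      rw [Fintype.card_subtype, ← Finset.sum_boole, h]
      congr 1
      simp only [Nat.add_sub_cancel, mul_ite, mul_one, mul_zero, Finset.sum_ite_eq',
        Finset.mem_range]
      split_ifs with hj
      · rfl
      · rw [Nat.choose_eq_zero_of_lt (by omega)]
        simp
    rw [hcard]
    rcases le_or_gt j m with hj | hj
    · obtain ⟨d, rfl⟩ := Nat.exists_eq_add_of_le hj
      have hq : 1 - ((σa : ℝ) - 1) / σa = 1 / σa := by
        field_simp
        ring
      rw [hq, Nat.add_sub_cancel_left, div_pow, div_pow, one_pow]
      field_simp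
      ring
    · simp [Nat.choose_eq_zero_of_lt hj]
  · rw [sum_runCount_ofFn m fun r => ((1 + (r + 1) / 2 : ℕ) : ℝ)]
    have hsum : ∑ k ∈ Finset.range (m + 1),
          (m.choose k : ℝ) * (((σa : ℝ) - 1) ^ k * ((1 + (k + 1 + 1) / 2 : ℕ) : ℝ)) =
        7 / 4 * ∑ k ∈ Finset.range (m + 1), (m.choose k : ℝ) * ((σa : ℝ) - 1) ^ k +
          1 / 2 * ∑ k ∈ Finset.range (m + 1), (m.choose k : ℝ) * (((σa : ℝ) - 1) ^ k * k) +
          1 / 4 * ∑ k ∈ Finset.range (m + 1), (m.choose k : ℝ) * (1 - (σa : ℝ)) ^ k := by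
      simp only [Finset.mul_sum, ← Finset.sum_add_distrib]
      refine Finset.sum_congr rfl fun k _ => ?_
      rw [cast_one_add_succ_div_two, ← neg_sub (σa : ℝ) 1, neg_pow ((σa : ℝ) - 1)]
      push_cast
      ring
    have hid := sum_choose_mul_pow_mul_id m ((σa : ℝ) - 1)
    rw [sub_add_cancel] at hid
    rw [hsum, sum_choose_mul_pow, sum_choose_mul_pow, sub_add_cancel,
      show 1 - (σa : ℝ) + 1 = 2 - σa by ring, mul_add, mul_add, mul_left_comm _ (1 / 2 : ℝ), hid, div_pow]
    push_cast
    field_simp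
    ring
end

section
/- Lower bound for admissible schemes: every admissible bilateral run-peeling decomposition of a nonempty string s with r maximal runs uses at least ⌈r/2⌉ content tokens, and the Flashback decomposition attains this minimum (it uses exactly ⌈r/2⌉ content tokens). -/
/-- Admissible bilateral run-peeling decompositions of a nonempty span: if the
span consists of at most two maximal runs, emit one terminal token for the span
and stop; otherwise choose any `1 ≤ x ≤ L` and `1 ≤ y ≤ R` (where `L`, `R` are
the lengths of the maximal leading and trailing runs), emit the content token
formed by the peeled prefix of length `x` and the peeled suffix of length `y`,
and recurse on the remaining middle.  Flashback is the special case
`x = L`, `y = R` at every step. -/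
inductive Admissible {α : Type*} [DecidableEq α] : List α → List (Tok α) → Prop
  | terminal (w : List α) (hw : w ≠ []) (hr : runCount w ≤ 2) :
      Admissible w [⟨w, 0⟩]
  | step (w : List α) (x y : ℕ) (T : List (Tok α)) (hw : w ≠ [])
      (hr : 3 ≤ runCount w)
      (hx1 : 1 ≤ x) (hx2 : x ≤ leadRunLen w)
      (hy1 : 1 ≤ y) (hy2 : y ≤ trailRunLen w)
      (ih : Admissible ((w.drop x).take (w.length - x - y)) T) :
      Admissible w (⟨w.take x ++ w.drop (w.length - y), x⟩ :: T)

section RunPeeling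

variable {α : Type*}

lemma take_length_sub_eq_reverse_drop_reverse (w : List α) (y : ℕ) :
    w.take (w.length - y) = (w.reverse.drop y).reverse := by
  simp [List.drop_reverse]

lemma take_drop_middle (w : List α) (x y : ℕ) :
    (w.drop x).take (w.length - x - y) = (w.take (w.length - y)).drop x := by
  rw [List.drop_take]
  congr 1
  omega

lemma reverse_eq_getLastD_cons (a : α) (t : List α) :
    ∃ u, (a :: t).reverse = (a :: t).getLastD a :: u := by
  rcases List.eq_nil_or_concat (a :: t) with h | ⟨l, b, h⟩
  · simp at h
  · rw [h]; exact ⟨l.reverse, by simp⟩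

variable [DecidableEq α]

lemma runCount_pos {w : List α} (hw : w ≠ []) : 1 ≤ runCount w := by
  induction w with
  | nil => exact absurd rfl hw
  | cons a t ih =>
    cases t with
    | nil => simp [runCount]
    | cons b t => have := ih (by simp); simp only [runCount]; omega

lemma runCount_append_pair (l : List α) (a b : α) :
    runCount (l ++ [a, b]) = runCount (l ++ [a]) + if a = b then 0 else 1 := by
  induction l with
  | nil => simp [runCount]; omega
  | cons c t ih =>
    cases t with
    | nil => simp [runCount] at ih ⊢; omega
    | cons d t => simp only [List.cons_append, runCount] at ih ⊢; omega

lemma runCount_reverse_s9 (w : List α) : runCount w.reverse = runCount w := by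
  induction w with
  | nil => rfl
  | cons a t ih =>
    cases t with
    | nil => rfl
    | cons b t =>
      have h := runCount_append_pair t.reverse b a
      simp only [List.reverse_cons, List.append_assoc, List.cons_append, List.nil_append] at ih ⊢
      rw [h, ih, runCount]
      simp only [eq_comm (a := a)]
      omega

lemma leadRunLen_cons_cons (a b : α) (t : List α) :
    leadRunLen (a :: b :: t) = if a = b then leadRunLen (b :: t) + 1 else 1 := by
  by_cases h : a = b
  · subst h; simp [leadRunLen]
  · simp [leadRunLen, h, Ne.symm h]

lemma leadRunLen_le_length (w : List α) : leadRunLen w ≤ w.length := by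
  cases w with
  | nil => simp [leadRunLen]
  | cons a t => simpa [leadRunLen] using (List.takeWhile_prefix _).length_le

lemma leadRunLen_pos {w : List α} (hw : w ≠ []) : 1 ≤ leadRunLen w := by
  cases w with
  | nil => exact absurd rfl hw
  | cons a t => simp [leadRunLen]

lemma runCount_drop_leadRunLen {w : List α} (hw : w ≠ []) :
    runCount w = runCount (w.drop (leadRunLen w)) + 1 := by
  induction w with
  | nil => exact absurd rfl hw
  | cons a t ih =>
    cases t with
    | nil => simp [runCount, leadRunLen]
    | cons b t =>
      have := ih (by simp)
      rw [leadRunLen_cons_cons]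
      by_cases h : a = b
      · simpa [h, runCount] using this
      · simp [h, runCount]; omega

lemma runCount_le_runCount_drop {w : List α} {x : ℕ} (hx : x ≤ leadRunLen w) :
    runCount w ≤ runCount (w.drop x) + 1 := by
  induction w generalizing x with
  | nil => simp [runCount]
  | cons a t ih =>
    cases x with
    | zero => simp
    | succ x =>
      cases t with
      | nil => simp [runCount]
      | cons b t =>
        rw [leadRunLen_cons_cons] at hx
        by_cases h : a = b
        · simpa [h, runCount] using ih (x := x) (by simpa [h] using hx)
        · have : x = 0 := by simpa [h] using hx
          subst this
          simp [h, runCount]; omega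

lemma runCount_drop_of_lt_leadRunLen {w : List α} {x : ℕ} (hx : x < leadRunLen w) :
    runCount (w.drop x) = runCount w := by
  induction w generalizing x with
  | nil => simp
  | cons a t ih =>
    cases x with
    | zero => simp
    | succ x =>
      cases t with
      | nil => simp [leadRunLen] at hx
      | cons b t =>
        rw [leadRunLen_cons_cons] at hx
        by_cases h : a = b
        · simpa [h, runCount] using ih (x := x) (by simpa [h] using hx)
        · simp [h] at hx

lemma leadRunLen_take (w : List α) (k : ℕ) :
    leadRunLen (w.take k) = min k (leadRunLen w) := by
  induction w generalizing k with
  | nil => simp [leadRunLen]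
  | cons a t ih =>
    match k, t with
    | 0, _ => simp [leadRunLen]
    | k + 1, [] => simp [leadRunLen]
    | 1, b :: t => simp [leadRunLen]
    | k + 2, b :: t =>
      have := ih (k + 1)
      simp only [List.take_succ_cons] at this ⊢
      rw [leadRunLen_cons_cons, leadRunLen_cons_cons]
      split_ifs <;> omega

lemma runCount_le_runCount_take {w : List α} {y : ℕ} (hy : y ≤ trailRunLen w) :
    runCount w ≤ runCount (w.take (w.length - y)) + 1 := by
  rw [take_length_sub_eq_reverse_drop_reverse, runCount_reverse_s9, ← runCount_reverse_s9 w]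
  exact runCount_le_runCount_drop hy

lemma runCount_take_trailRunLen {w : List α} (hw : w ≠ []) :
    runCount w = runCount (w.take (w.length - trailRunLen w)) + 1 := by
  rw [take_length_sub_eq_reverse_drop_reverse, runCount_reverse_s9, ← runCount_reverse_s9 w]
  exact runCount_drop_leadRunLen (by simpa using hw)

lemma runCount_le_runCount_middle {w : List α} {x y : ℕ}
    (hx : x ≤ leadRunLen w) (hy : y ≤ trailRunLen w)
    (hm : (w.drop x).take (w.length - x - y) ≠ []) :
    runCount w ≤ runCount ((w.drop x).take (w.length - x - y)) + 2 := by
  rw [take_drop_middle] at hm ⊢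
  have h1 := runCount_le_runCount_take hy
  have hlen : x < w.length - y := by
    by_contra hcon
    exact hm (List.drop_eq_nil_of_le (by simp; omega))
  have h2 := runCount_le_runCount_drop (w := w.take (w.length - y)) (x := x)
    (by rw [leadRunLen_take]; omega)
  omega

lemma runCount_middle_maximal {w : List α} (hr : 3 ≤ runCount w) :
    runCount w =
      runCount ((w.drop (leadRunLen w)).take (w.length - leadRunLen w - trailRunLen w)) + 2 := by
  have hw : w ≠ [] := by rintro rfl; simp [runCount] at hr
  rw [take_drop_middle]
  have h1 := runCount_take_trailRunLen hw
  have hu : w.take (w.length - trailRunLen w) ≠ [] := by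
    intro h; rw [h] at h1; simp [runCount] at h1; omega
  have h2 := runCount_drop_leadRunLen hu
  rw [leadRunLen_take] at h2
  rcases le_total (w.length - trailRunLen w) (leadRunLen w) with h | h
  · rw [min_eq_left h, List.drop_eq_nil_of_le (by simp)] at h2
    simp [runCount] at h2; omega
  · rw [min_eq_right h] at h2
    omega

lemma length_le_leadRunLen_add_trailRunLen {w : List α} (hw : w ≠ []) (hr : runCount w ≤ 2) :
    w.length ≤ leadRunLen w + trailRunLen w := by
  have h1 := runCount_take_trailRunLen hw
  by_cases hu : w.take (w.length - trailRunLen w) = []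
  · simp [hw] at hu; omega
  have h2 := runCount_drop_leadRunLen hu
  have h3 : (w.take (w.length - trailRunLen w)).drop
      (leadRunLen (w.take (w.length - trailRunLen w))) = [] := by
    by_contra h
    have := runCount_pos h
    omega
  rw [List.drop_eq_nil_iff, leadRunLen_take] at h3
  simp at h3
  omega

lemma leadRunLen_eq_takeWhile (a : α) (t : List α) :
    leadRunLen (a :: t) = ((a :: t).takeWhile (fun x => decide (x = a))).length := by
  simp [leadRunLen]

lemma takeWhile_eq_take_leadRunLen (a : α) (t : List α) :
    (a :: t).takeWhile (fun x => decide (x = a)) = (a :: t).take (leadRunLen (a :: t)) := by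
  rw [leadRunLen_eq_takeWhile]
  exact (List.prefix_iff_eq_take.mp (List.takeWhile_prefix _))

lemma dropWhile_eq_drop_leadRunLen (a : α) (t : List α) :
    (a :: t).dropWhile (fun x => decide (x = a)) = (a :: t).drop (leadRunLen (a :: t)) := by
  have h := List.takeWhile_append_dropWhile (p := fun x => decide (x = a)) (l := a :: t)
  rw [takeWhile_eq_take_leadRunLen] at h
  exact List.append_cancel_left (h.trans (List.take_append_drop _ _).symm)

lemma backRun_eq_drop_trailRunLen (a : α) (t : List α) :
    ((a :: t).reverse.takeWhile
      (fun x => decide (x = (a :: t).getLastD a))).reverse =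
      (a :: t).drop ((a :: t).length - trailRunLen (a :: t)) := by
  obtain ⟨u, hu⟩ := reverse_eq_getLastD_cons a t
  rw [trailRunLen]
  have h : ((a :: t).reverse.takeWhile (fun x => decide (x = (a :: t).getLastD a))) =
      (a :: t).reverse.take (leadRunLen (a :: t).reverse) := by
    rw [hu]
    exact takeWhile_eq_take_leadRunLen _ _
  rw [h, List.take_reverse, List.reverse_reverse]

lemma trailRunLen_le_length (w : List α) : trailRunLen w ≤ w.length := by
  simpa [trailRunLen] using leadRunLen_le_length w.reverse

/-- A string with at least two runs has disjoint leading and trailing runs. -/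
lemma leadRunLen_add_trailRunLen_le_length {w : List α} (hr : 2 ≤ runCount w) :
    leadRunLen w + trailRunLen w ≤ w.length := by
  have hw : w ≠ [] := by rintro rfl; simp [runCount] at hr
  by_contra hcon
  have h1 := leadRunLen_le_length w
  have h2 := trailRunLen_le_length w
  -- The prefix before the trailing run, and one more symbol, lie in the leading run.
  have h4 : runCount (w.take (w.length - trailRunLen w + 1)) ≤ 1 := by
    by_cases he : w.take (w.length - trailRunLen w + 1) = []
    · simp [he, runCount]
    rw [runCount_drop_leadRunLen he, leadRunLen_take, min_eq_left (by omega),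
      List.drop_eq_nil_of_le (by simp)]
    simp [runCount]
  have hp : 1 ≤ trailRunLen w := leadRunLen_pos (by simpa using hw)
  have h5 : runCount w ≤ runCount (w.take (w.length - (trailRunLen w - 1))) := by
    rw [take_length_sub_eq_reverse_drop_reverse, runCount_reverse_s9, ← runCount_reverse_s9 w]
    exact (runCount_drop_of_lt_leadRunLen (by rw [← trailRunLen]; omega)).ge
  rw [show w.length - (trailRunLen w - 1) = w.length - trailRunLen w + 1 by omega] at h5
  omega

lemma peelF_succ_of_runCount_le_two (n : ℕ) {w : List α} (hw : w ≠ []) (hr : runCount w ≤ 2) :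
    peelF (n + 1) w = [⟨w, 0⟩] := by
  obtain ⟨a, t, rfl⟩ := List.exists_cons_of_ne_nil hw
  have h1 := length_le_leadRunLen_add_trailRunLen hw hr
  have h2 := trailRunLen_le_length (a :: t)
  simp only [peelF, backRun_eq_drop_trailRunLen, takeWhile_eq_take_leadRunLen,
    dropWhile_eq_drop_leadRunLen]
  by_cases he : (a :: t).drop (leadRunLen (a :: t)) = []
  · simp [he]
  have hr2 : 2 ≤ runCount (a :: t) := by
    have := runCount_drop_leadRunLen hw
    have := runCount_pos he
    omega
  have h3 := leadRunLen_add_trailRunLen_le_length hr2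
  rw [if_neg (by simpa using he), if_pos,
    show (a :: t).length - trailRunLen (a :: t) = leadRunLen (a :: t) by omega,
    List.take_append_drop]
  rw [List.isEmpty_iff, List.take_eq_nil_iff]
  left
  simp only [List.length_drop]
  omega

lemma peelF_succ_of_three_le_runCount (n : ℕ) {w : List α} (hr : 3 ≤ runCount w) :
    peelF (n + 1) w =
      ⟨w.take (leadRunLen w) ++ w.drop (w.length - trailRunLen w), leadRunLen w⟩ ::
        peelF n ((w.drop (leadRunLen w)).take (w.length - leadRunLen w - trailRunLen w)) := by
  have hw : w ≠ [] := by rintro rfl; simp [runCount] at hr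
  obtain ⟨a, t, rfl⟩ := List.exists_cons_of_ne_nil hw
  have h1 := leadRunLen_le_length (a :: t)
  have h2 := trailRunLen_le_length (a :: t)
  have hm := runCount_middle_maximal hr
  have hlen : ((a :: t).drop (leadRunLen (a :: t))).length -
      ((a :: t).drop ((a :: t).length - trailRunLen (a :: t))).length =
      (a :: t).length - leadRunLen (a :: t) - trailRunLen (a :: t) := by
    simp only [List.length_drop]; omega
  simp only [peelF, backRun_eq_drop_trailRunLen, takeWhile_eq_take_leadRunLen,
    dropWhile_eq_drop_leadRunLen, hlen]
  have hne : ((a :: t).drop (leadRunLen (a :: t))).take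
      ((a :: t).length - leadRunLen (a :: t) - trailRunLen (a :: t)) ≠ [] := by
    intro h; rw [h] at hm; simp [runCount] at hm; omega
  rw [if_neg, if_neg (by simpa only [List.isEmpty_iff] using hne), List.length_take,
    min_eq_left h1]
  intro h
  rw [List.isEmpty_iff] at h
  simp [h] at hne

lemma Admissible.ne_nil {w : List α} {T : List (Tok α)} (h : Admissible w T) : w ≠ [] := by
  cases h <;> assumption

lemma Admissible.runCount_le {w : List α} {T : List (Tok α)} (h : Admissible w T) :
    runCount w ≤ 2 * T.length := by
  induction h with
  | terminal w hw hr => simpa using hr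
  | step w x y T hw hr hx1 hx2 hy1 hy2 ih hrec =>
    have := runCount_le_runCount_middle hx2 hy2 ih.ne_nil
    simp only [List.length_cons]
    omega

lemma peelF_admissible_and_length (n : ℕ) {w : List α} (hw : w ≠ []) (hn : w.length ≤ n) :
    Admissible w (peelF n w) ∧ (peelF n w).length = (runCount w + 1) / 2 := by
  induction n generalizing w with
  | zero => exact absurd (List.length_eq_zero_iff.mp (by omega)) hw
  | succ n ih =>
    have hpos := runCount_pos hw
    rcases Nat.lt_or_ge 2 (runCount w) with hr | hr
    · have hm := runCount_middle_maximal hr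
      have hL := leadRunLen_pos hw
      have hR : 1 ≤ trailRunLen w := leadRunLen_pos (by simpa using hw)
      obtain ⟨h1, h2⟩ := ih
        (w := (w.drop (leadRunLen w)).take (w.length - leadRunLen w - trailRunLen w))
        (by intro h; rw [h] at hm; simp [runCount] at hm; omega)
        (by simp only [List.length_take, List.length_drop]; omega)
      rw [peelF_succ_of_three_le_runCount n hr]
      refine ⟨.step w _ _ _ hw hr hL le_rfl hR le_rfl h1, ?_⟩
      rw [List.length_cons, h2]
      omega
    · rw [peelF_succ_of_runCount_le_two n hw hr]
      refine ⟨.terminal w hw hr, ?_⟩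
      simp only [List.length_singleton]
      omega

end RunPeeling

/-- **Greedy optimality (lower bound).**  Every admissible bilateral
run-peeling decomposition of a nonempty string `s` with `r` maximal runs uses
at least `⌈r/2⌉` content tokens, and the Flashback decomposition (the maximal
peeling `peelF s.length s` of the bare string, i.e. the content tokens of
`F(s)`) is admissible and attains this minimum: it uses exactly `⌈r/2⌉`
content tokens. -/
theorem admissible_lower_bound {α : Type*} [DecidableEq α]
    (s : List α) (hs : s ≠ []) :
    (∀ T : List (Tok α), Admissible s T → (runCount s + 1) / 2 ≤ T.length) ∧
    Admissible s (peelF s.length s) ∧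
    (peelF s.length s).length = (runCount s + 1) / 2 := by
  refine ⟨fun T hT => ?_, peelF_admissible_and_length _ hs le_rfl⟩
  have := hT.runCount_le
  omega
end

section
/- Stability under single character edits: if a nonempty string t is obtained from a nonempty string s by a single character insertion, deletion, or substitution, then the numbers of maximal runs satisfy |r(t) − r(s)| ≤ 2, and consequently the Flashback token counts satisfy |k(t) − k(s)| ≤ 1, where k(u) = 1 + ⌈r(u)/2⌉. -/
/-- `t` is obtained from `s` by a single character insertion, deletion, or
substitution. -/
def SingleEdit {α : Type*} (s t : List α) : Prop :=
  (∃ (u v : List α) (c : α), s = u ++ v ∧ t = u ++ c :: v) ∨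
  (∃ (u v : List α) (c : α), s = u ++ c :: v ∧ t = u ++ v) ∨
  (∃ (u v : List α) (c c' : α), s = u ++ c :: v ∧ t = u ++ c' :: v)

theorem runCount_append_le_insert {α : Type*} [DecidableEq α] (u v : List α) (c : α) :
    runCount (u ++ v) ≤ runCount (u ++ c :: v) ∧
      runCount (u ++ c :: v) ≤ runCount (u ++ v) + 2 := by
  induction u with
  | nil =>
    cases v with
    | nil => simp [runCount]
    | cons b w =>
      simp only [List.nil_append, runCount]
      split_ifs <;> omega
  | cons a u ih =>
    cases u with
    | nil =>
      cases v with
      | nil =>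
        simp only [List.cons_append, List.nil_append, runCount]
        split_ifs <;> omega
      | cons b w =>
        simp only [List.cons_append, List.nil_append, runCount]
        split_ifs <;> first | omega | simp_all
    | cons b u =>
      simp only [List.cons_append, runCount] at ih ⊢
      omega


/-- **Stability under single character edits.**  If a nonempty string `t` is
obtained from a nonempty string `s` by a single character insertion, deletion,
or substitution, then `|r(t) - r(s)| ≤ 2` and consequently the Flashback token
counts `k(u) = 1 + ⌈r(u)/2⌉` satisfy `|k(t) - k(s)| ≤ 1`. -/
theorem flashback_edit_stability {α : Type*} [DecidableEq α]
    (s t : List α) (hs : s ≠ []) (ht : t ≠ []) (h : SingleEdit s t) :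
    |(runCount t : ℤ) - (runCount s : ℤ)| ≤ 2 ∧
    |((1 + (runCount t + 1) / 2 : ℕ) : ℤ) -
        ((1 + (runCount s + 1) / 2 : ℕ) : ℤ)| ≤ 1 := by
  have hr : runCount t ≤ runCount s + 2 ∧ runCount s ≤ runCount t + 2 := by
    rcases h with ⟨u, v, c, rfl, rfl⟩ | ⟨u, v, c, rfl, rfl⟩ | ⟨u, v, c, c', rfl, rfl⟩
    · have := runCount_append_le_insert u v c
      omega
    · have := runCount_append_le_insert u v c
      omega
    · have := runCount_append_le_insert u v c
      have := runCount_append_le_insert u v c'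
      omega
  constructor <;> rw [abs_le] <;> omega
end

section
/- Behavior under reversal: for every nonempty string s, the Flashback decomposition F(s^R) of the reversal of s has the same number of tokens as F(s); each content token of F(s^R) is the corresponding content token of F(s) with its front run and back run swapped (symbol string back·front, split equal to the original back-run length), and the terminal token of F(s^R) has symbol string equal to the reversal K(s)^R of the peeling kernel of s. -/
namespace Flashback

theorem exists_eq_replicate_append {β : Type*} (w : List β) (hw : w ≠ []) :
    ∃ (m : ℕ) (a : β) (r : List β),
      w = List.replicate (m + 1) a ++ r ∧ ∀ x ∈ r.head?, x ≠ a := by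
  induction w with
  | nil => exact absurd rfl hw
  | cons a t ih =>
    rcases t with _ | ⟨b, t⟩
    · exact ⟨0, a, [], by simp⟩
    · by_cases hab : b = a
      · obtain ⟨m, c, r, h, hr⟩ := ih (by simp)
        have hbc : b = c := by
          simpa [List.replicate_succ] using congrArg List.head? h
        refine ⟨m + 1, c, r, ?_, hr⟩
        rw [h, ← hab, hbc]
        simp [List.replicate_succ]
      · exact ⟨0, a, b :: t, by simp, by simpa using hab⟩

theorem takeWhile_replicate_append {β : Type*} [DecidableEq β] (m : ℕ) (a : β) (r : List β)
    (hr : ∀ x ∈ r.head?, x ≠ a) :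
    (List.replicate m a ++ r).takeWhile (fun x => decide (x = a)) = List.replicate m a := by
  induction m with
  | zero => cases r <;> simp_all
  | succ m ih => simp [List.replicate_succ, ih]

theorem dropWhile_replicate_append {β : Type*} [DecidableEq β] (m : ℕ) (a : β) (r : List β)
    (hr : ∀ x ∈ r.head?, x ≠ a) :
    (List.replicate m a ++ r).dropWhile (fun x => decide (x = a)) = r := by
  induction m with
  | zero => cases r <;> simp_all
  | succ m ih => simp [List.replicate_succ, ih]

/-- The shapes of a nonempty span met by bilateral peeling: a single run, two distinct runs, or
a span of the same kind enclosed by its maximal leading and trailing runs. -/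
inductive Span {β : Type*} : List β → Prop
  | run (m : ℕ) (a : β) : Span (List.replicate (m + 1) a)
  | pair (m n : ℕ) (a b : β) (hab : a ≠ b) :
      Span (List.replicate (m + 1) a ++ List.replicate (n + 1) b)
  | nest (m n : ℕ) (a b : β) (w : List β) (hw : w ≠ []) (ha : ∀ x ∈ w.head?, x ≠ a)
      (hb : ∀ x ∈ w.getLast?, x ≠ b) (h : Span w) :
      Span (List.replicate (m + 1) a ++ (w ++ List.replicate (n + 1) b))

theorem span_of_ne_nil {β : Type*} (w : List β) (hw : w ≠ []) : Span w := by
  induction hk : w.length using Nat.strong_induction_on generalizing w with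
  | _ k ih =>
    obtain ⟨m, a, r, rfl, hr⟩ := exists_eq_replicate_append w hw
    rcases eq_or_ne r [] with rfl | hr0
    · simpa using Span.run m a
    obtain ⟨n, b, q, hq, hqb⟩ := exists_eq_replicate_append r.reverse (by simpa using hr0)
    obtain rfl : r = q.reverse ++ List.replicate (n + 1) b := by
      simpa using congrArg List.reverse hq
    rcases eq_or_ne q [] with rfl | hq0
    · have hab : a ≠ b := by
        simpa [List.replicate_succ, eq_comm] using hr
      simpa using Span.pair m n a b hab
    · have hq0' : q.reverse ≠ [] := by simpa using hq0
      refine Span.nest m n a b q.reverse hq0' ?_ (by simpa using hqb)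
        (ih _ ?_ _ hq0' rfl)
      · intro x hx
        refine hr x ?_
        rw [List.head?_append, Option.mem_def.1 hx]
        rfl
      · subst hk
        simp only [List.length_append, List.length_replicate]
        omega

theorem peelF_run {β : Type*} [DecidableEq β] (k m : ℕ) (a : β) :
    peelF (k + 1) (List.replicate (m + 1) a) = [⟨List.replicate (m + 1) a, 0⟩] := by
  simp [List.replicate_succ, peelF]

/-- One peeling step on a span with leading run `a ^ (m + 1)` and trailing run `b ^ (n + 1)`. -/
theorem peelF_step {β : Type*} [DecidableEq β] (k m n : ℕ) (a b : β) (w : List β)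
    (ha : ∀ x ∈ (w ++ List.replicate (n + 1) b).head?, x ≠ a)
    (hb : ∀ x ∈ (List.replicate (m + 1) a ++ w).getLast?, x ≠ b) :
    peelF (k + 1) (List.replicate (m + 1) a ++ (w ++ List.replicate (n + 1) b)) =
      if w.isEmpty then [⟨List.replicate (m + 1) a ++ List.replicate (n + 1) b, 0⟩]
      else ⟨List.replicate (m + 1) a ++ List.replicate (n + 1) b, m + 1⟩ :: peelF k w := by
  obtain ⟨v, hv⟩ : ∃ v, v = List.replicate (m + 1) a ++ (w ++ List.replicate (n + 1) b) := ⟨_, rfl⟩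
  have hfront : v.takeWhile (fun x => decide (x = a)) = List.replicate (m + 1) a := by
    rw [hv, takeWhile_replicate_append _ _ _ ha]
  have hrest : v.dropWhile (fun x => decide (x = a)) = w ++ List.replicate (n + 1) b := by
    rw [hv, dropWhile_replicate_append _ _ _ ha]
  have hlast : v.getLastD a = b := by
    rw [hv, List.getLastD_eq_getLast?, List.replicate_succ' (n := n)]
    simp [← List.append_assoc]
  have hback : v.reverse.takeWhile (fun x => decide (x = b)) = List.replicate (n + 1) b := by
    have : v.reverse = List.replicate (n + 1) b ++ (List.replicate (m + 1) a ++ w).reverse := by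
      simp [hv]
    rw [this, takeWhile_replicate_append _ _ _ (by rwa [List.head?_reverse])]
  rw [← hv]
  obtain ⟨t, ht⟩ : ∃ t, v = a :: t := ⟨_, by rw [hv, List.replicate_succ]; rfl⟩
  rw [ht] at hfront hrest hlast hback ⊢
  simp only [peelF, hfront, hrest, hlast, hback]
  simp

theorem peelF_pair {β : Type*} [DecidableEq β] (k m n : ℕ) (a b : β) (hab : a ≠ b) :
    peelF (k + 1) (List.replicate (m + 1) a ++ List.replicate (n + 1) b) =
      [⟨List.replicate (m + 1) a ++ List.replicate (n + 1) b, 0⟩] := by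
  simpa using peelF_step k m n a b [] (by simpa [List.replicate_succ] using hab.symm)
    (by simpa [List.replicate_succ'] using hab)

theorem peelF_nest {β : Type*} [DecidableEq β] (k m n : ℕ) (a b : β) (w : List β) (hw : w ≠ [])
    (ha : ∀ x ∈ w.head?, x ≠ a) (hb : ∀ x ∈ w.getLast?, x ≠ b) :
    peelF (k + 1) (List.replicate (m + 1) a ++ (w ++ List.replicate (n + 1) b)) =
      ⟨List.replicate (m + 1) a ++ List.replicate (n + 1) b, m + 1⟩ :: peelF k w := by
  rw [peelF_step k m n a b w, if_neg (by simpa using hw)]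
  · rwa [List.head?_append_of_ne_nil _ hw]
  · rwa [List.getLast?_append_of_ne_nil _ hw]

/-- The token with front and back exchanged. -/
def swapTok {β : Type*} (τ : Tok β) : Tok β :=
  ⟨τ.sym.drop τ.split ++ τ.sym.take τ.split, τ.sym.length - τ.split⟩

/-- Exchange front and back of all tokens but the last, whose symbol string is reversed. -/
def mirror {β : Type*} : List (Tok β) → List (Tok β)
  | [] => []
  | [τ] => [⟨τ.sym.reverse, 0⟩]
  | τ :: σ :: T => swapTok τ :: mirror (σ :: T)

theorem mirror_cons {β : Type*} (τ : Tok β) (T : List (Tok β)) (hT : T ≠ []) :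
    mirror (τ :: T) = swapTok τ :: mirror T := by
  cases T with
  | nil => exact absurd rfl hT
  | cons σ T => rfl

theorem length_mirror {β : Type*} (T : List (Tok β)) : (mirror T).length = T.length := by
  induction T with
  | nil => rfl
  | cons τ T ih => cases T <;> simp_all [mirror]

theorem getD_mirror {β : Type*} (T : List (Tok β)) (j : ℕ) (hj : j + 1 < T.length) :
    (mirror T).getD j default = swapTok (T.getD j default) := by
  induction T generalizing j with
  | nil => simp at hj
  | cons τ T ih =>
    rw [mirror_cons τ T (by rintro rfl; simp at hj)]
    cases j with
    | zero => rfl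
    | succ j => simpa using ih j (by simpa using hj)

theorem sym_getLastD_mirror {β : Type*} (T : List (Tok β)) (d : Tok β) (hT : T ≠ []) :
    ((mirror T).getLastD d).sym = (T.getLastD d).sym.reverse := by
  induction T generalizing d with
  | nil => exact absurd rfl hT
  | cons τ T ih =>
    cases T with
    | nil => rfl
    | cons σ T =>
      have := ih d (by simp)
      rw [mirror_cons _ _ (by simp)]
      rcases h : mirror (σ :: T) with _ | ⟨ρ, R⟩
      · simpa [h] using length_mirror (σ :: T)
      · simpa [h] using this

theorem peelF_ne_nil {β : Type*} [DecidableEq β] (k : ℕ) (w : List β) (hw : w ≠ []) :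
    peelF (k + 1) w ≠ [] := by
  cases span_of_ne_nil w hw with
  | run m a => simp [peelF_run]
  | pair m n a b hab => simp [peelF_pair _ _ _ _ _ hab]
  | nest m n a b v hv ha hb => simp [peelF_nest _ _ _ _ _ _ hv ha hb]

theorem peelF_reverse {β : Type*} [DecidableEq β] (k : ℕ) (w : List β)
    (hw : w ≠ []) (hk : w.length ≤ k) :
    peelF k w.reverse = mirror (peelF k w) := by
  induction span_of_ne_nil w hw generalizing k with
  | run m a =>
    obtain ⟨k, rfl⟩ : ∃ l, k = l + 1 := ⟨k - 1, by simp at hk; omega⟩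
    simp only [List.reverse_replicate, peelF_run, mirror]
  | pair m n a b hab =>
    obtain ⟨k, rfl⟩ : ∃ l, k = l + 1 := ⟨k - 1, by simp at hk; omega⟩
    simp only [List.reverse_append, List.reverse_replicate, peelF_pair _ _ _ _ _ hab,
      peelF_pair _ _ _ _ _ hab.symm, mirror]
  | nest m n a b v hv ha hb _ ih =>
    simp only [List.length_append, List.length_replicate] at hk
    obtain ⟨k, rfl⟩ : ∃ l, k = l + 1 + 1 :=
      ⟨k - 2, by omega⟩
    have hrev : (List.replicate (m + 1) a ++ (v ++ List.replicate (n + 1) b)).reverse =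
        List.replicate (n + 1) b ++ (v.reverse ++ List.replicate (m + 1) a) := by
      simp
    rw [hrev, peelF_nest _ _ _ _ _ _ hv ha hb, mirror_cons _ _ (peelF_ne_nil _ _ hv),
      peelF_nest _ _ _ _ _ _ (by simpa using hv) (by simpa using hb) (by simpa using ha),
      ih _ hv (by omega)]
    simp [swapTok]

theorem flashback_eq_cons {α : Type*} [DecidableEq α] (s : List α) (hs : s ≠ []) :
    flashback s = ⟨[atSym, dollarSym], 1⟩ ::
      peelF (s.length + 1) (s.map (Sum.inl : α → Symb α)) := by
  have h := peelF_nest (s.length + 1) 0 0 (atSym : Symb α) dollarSym (s.map Sum.inl)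
    (by simpa using hs) (by simp [atSym]) (by simp [dollarSym])
  simpa [flashback, wrap] using h

end Flashback

/-- **Behaviour under reversal.**  For every nonempty string `s`, `F(s^R)` has
the same number of tokens as `F(s)`; each content token of `F(s^R)` is the
corresponding content token of `F(s)` with front and back runs swapped (symbol
string `back · front`, split equal to the original back-run length); and the
terminal token of `F(s^R)` has symbol string `K(s)^R`, the reversal of the
peeling kernel of `s`. -/
theorem flashback_reversal {α : Type*} [DecidableEq α]
    (s : List α) (hs : s ≠ []) :
    (flashback s.reverse).length = (flashback s).length ∧
    (∀ j, 1 ≤ j → j + 1 < (flashback s).length →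
      (flashback s.reverse).getD j default =
        ⟨((flashback s).getD j default).sym.drop
            ((flashback s).getD j default).split ++
          ((flashback s).getD j default).sym.take
            ((flashback s).getD j default).split,
          ((flashback s).getD j default).sym.length -
            ((flashback s).getD j default).split⟩) ∧
    ((flashback s.reverse).getLastD default).sym =
      ((flashback s).getLastD default).sym.reverse := by
  have hF := Flashback.flashback_eq_cons s hs
  have hR := Flashback.flashback_eq_cons s.reverse (by simpa using hs)
  have hs' : s.map (Sum.inl : α → Symb α) ≠ [] := by simpa using hs
  have hT := Flashback.peelF_ne_nil s.length _ hs'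
  rw [List.map_reverse, List.length_reverse,
    Flashback.peelF_reverse _ _ hs' (by simp)] at hR
  rw [hR, hF]
  refine ⟨by simp [Flashback.length_mirror], ?_, ?_⟩
  · rintro (_ | j) h1 hj
    · omega
    · exact Flashback.getD_mirror _ j (by simpa using hj)
  · have h := Flashback.sym_getLastD_mirror _ ⟨[atSym, dollarSym], 1⟩ hT
    simpa only [List.getLastD_cons] using h
end

section
/- Behavior under uniform run-length dilation: fix c ≥ 1 and let h_c be the morphism sending each symbol a to a^c (a repeated c times). For every nonempty string s, the Flashback decomposition F(h_c(s)) has the same number of tokens as F(s); each content token (σ_j, p_j) of F(s) is replaced in F(h_c(s)) by (h_c(σ_j), c·p_j), and the terminal symbol string is likewise replaced by its image under h_c. -/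
/-- The uniform run-length dilation morphism `h_c`, sending each symbol `a` to
`a^c` and extending to strings by concatenation. -/
def dilate {α : Type*} (c : ℕ) (s : List α) : List α :=
  s.flatMap fun x => List.replicate c x

section Dilate

variable {β : Type*} (c : ℕ)

@[simp] theorem dilate_nil : dilate c ([] : List β) = [] := rfl

theorem dilate_cons (a : β) (t : List β) :
    dilate c (a :: t) = List.replicate c a ++ dilate c t := rfl

theorem dilate_append (s t : List β) : dilate c (s ++ t) = dilate c s ++ dilate c t :=
  List.flatMap_append

theorem length_dilate (s : List β) : (dilate c s).length = c * s.length := by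
  induction s with
  | nil => simp
  | cons a t ih => rw [dilate_cons, List.length_append, ih, List.length_replicate,
      List.length_cons]; ring

theorem dilate_reverse (s : List β) : dilate c s.reverse = (dilate c s).reverse := by
  induction s with
  | nil => simp
  | cons a t ih => simp [dilate_append, dilate_cons, ih]

theorem dilate_map {γ : Type*} (f : β → γ) (s : List β) :
    dilate c (s.map f) = (dilate c s).map f := by
  induction s with
  | nil => simp
  | cons a t ih => simp [dilate_cons, ih]

theorem dilate_take (n : ℕ) (s : List β) :
    dilate c (s.take n) = (dilate c s).take (c * n) := by
  have h := dilate_append c (s.take n) (s.drop n)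
  rw [List.take_append_drop] at h
  rcases le_total n s.length with hn | hn
  · rw [h, List.take_left']
    rw [length_dilate, List.length_take, min_eq_left hn]
  · rw [List.take_of_length_le hn, List.take_of_length_le]
    rw [length_dilate]
    exact Nat.mul_le_mul_left c hn

variable {c}

theorem dilate_eq_nil_iff (hc : 1 ≤ c) {s : List β} : dilate c s = [] ↔ s = [] := by
  rw [← List.length_eq_zero_iff, ← List.length_eq_zero_iff, length_dilate]
  simp only [mul_eq_zero]
  omega

theorem isEmpty_dilate (hc : 1 ≤ c) (s : List β) : (dilate c s).isEmpty = s.isEmpty := by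
  rw [Bool.eq_iff_iff, List.isEmpty_iff, List.isEmpty_iff, dilate_eq_nil_iff hc]

theorem takeWhile_dilate (hc : 1 ≤ c) (p : β → Bool) (s : List β) :
    (dilate c s).takeWhile p = dilate c (s.takeWhile p) := by
  induction s with
  | nil => simp
  | cons a t ih =>
    by_cases h : p a
    · rw [List.takeWhile_cons_of_pos h, dilate_cons, dilate_cons,
        List.takeWhile_append_of_pos (by simp [h]), ih]
    · obtain ⟨k, rfl⟩ := Nat.exists_eq_add_of_le' hc
      simp [dilate_cons, List.replicate_succ, h]

theorem dropWhile_dilate (hc : 1 ≤ c) (p : β → Bool) (s : List β) :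
    (dilate c s).dropWhile p = dilate c (s.dropWhile p) := by
  have h := List.takeWhile_append_dropWhile (p := p) (l := dilate c s)
  rw [takeWhile_dilate hc] at h
  refine List.append_cancel_left (h.trans ?_)
  rw [← dilate_append, List.takeWhile_append_dropWhile]

theorem getLastD_dilate (hc : 1 ≤ c) (s : List β) (d : β) :
    (dilate c s).getLastD d = s.getLastD d := by
  obtain ⟨k, rfl⟩ := Nat.exists_eq_add_of_le' hc
  induction s using List.reverseRecOn with
  | nil => rfl
  | append_singleton t a =>
    simp [dilate_append, dilate_cons, List.replicate_succ', ← List.append_assoc]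

end Dilate

/-- The image of a token under the dilation morphism. -/
def Tok.dilate {β : Type*} (c : ℕ) (τ : Tok β) : Tok β :=
  ⟨_root_.dilate c τ.sym, c * τ.split⟩

theorem peelF_nil {β : Type*} [DecidableEq β] (f : ℕ) : peelF f ([] : List β) = [] := by
  cases f <;> rfl

theorem peelF_dilate {β : Type*} [DecidableEq β] {c : ℕ} (hc : 1 ≤ c) (f g : ℕ) (w : List β)
    (hf : w.length ≤ f) (hg : c * w.length ≤ g) :
    peelF g (dilate c w) = (peelF f w).map (Tok.dilate c) := by
  induction f generalizing g w with
  | zero =>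
    obtain rfl : w = [] := List.length_eq_zero_iff.mp (by omega)
    simp [peelF_nil]
  | succ f ih =>
    cases w with
    | nil => simp [peelF_nil]
    | cons a t =>
      obtain ⟨t', ht'⟩ : ∃ t', dilate c (a :: t) = a :: t' := by
        obtain ⟨k, rfl⟩ := Nat.exists_eq_add_of_le' hc
        exact ⟨_, rfl⟩
      rw [List.length_cons] at hf hg
      rw [mul_add] at hg
      obtain ⟨g, rfl⟩ : ∃ g', g = g' + 1 := ⟨g - 1, by omega⟩
      have hdrop : ((a :: t).dropWhile fun x => decide (x = a)).length ≤ t.length := by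
        rw [List.dropWhile_cons_of_pos (by simp)]
        exact (List.dropWhile_sublist _).length_le
      rw [ht']
      simp only [peelF]
      rw [← ht', takeWhile_dilate hc, dropWhile_dilate hc, getLastD_dilate hc, ← dilate_reverse,
        takeWhile_dilate hc, ← dilate_reverse, length_dilate, length_dilate, length_dilate,
        ← Nat.mul_sub, ← dilate_take, isEmpty_dilate hc, isEmpty_dilate hc, ← dilate_append]
      generalize (a :: t).dropWhile _ = rest at *
      generalize List.reverse (List.takeWhile _ _) = back
      split_ifs
      · simp [Tok.dilate]
      · simp [Tok.dilate]
      · have hmid : (rest.take (rest.length - back.length)).length ≤ t.length :=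
          (List.length_take_le' _ _).trans hdrop
        have hmul := Nat.mul_le_mul_left c hmid
        rw [ih g _ (by omega) (by omega)]
        simp [Tok.dilate]

theorem flashback_eq_cons {α : Type*} [DecidableEq α] {s : List α} (hs : s ≠ []) :
    flashback s = ⟨[atSym, dollarSym], 1⟩ ::
      peelF (s.length + 1) (s.map (Sum.inl : α → Symb α)) := by
  have hfront : (wrap s).takeWhile (fun x => decide (x = atSym)) = [atSym] := by
    cases s <;> simp [wrap, atSym, dollarSym]
  have hrest : (wrap s).dropWhile (fun x => decide (x = atSym)) =
      s.map Sum.inl ++ [dollarSym] := by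
    cases s <;> simp [wrap, atSym, dollarSym]
  have hlast : (wrap s).getLastD atSym = dollarSym := by
    rw [wrap, List.getLastD_eq_getLast?, List.getLast?_concat, Option.getD_some]
  have hback : (wrap s).reverse.takeWhile (fun x => decide (x = dollarSym)) = [dollarSym] := by
    cases s using List.reverseRecOn <;> simp [wrap, atSym, dollarSym]
  have hlen : (wrap s).length = s.length + 1 + 1 := by simp [wrap]
  have hcons : wrap s = atSym :: (s.map Sum.inl ++ [dollarSym]) := rfl
  rw [flashback, hlen]
  conv_lhs => rw [hcons]
  simp only [peelF]
  rw [← hcons, hfront, hrest, hlast, hback]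
  simp [hs]

/-- **Behaviour under uniform run-length dilation.**  Fix `c ≥ 1`.  For every
nonempty string `s`, `F(h_c(s))` has the same number of tokens as `F(s)`, and
every token of `F(s)` other than the initial sentinel token — each content
token `(σ_j, p_j)` and the terminal token — is replaced in `F(h_c(s))` by
`(h_c(σ_j), c·p_j)`. -/
theorem flashback_dilation {α : Type*} [DecidableEq α]
    (c : ℕ) (hc : 1 ≤ c) (s : List α) (hs : s ≠ []) :
    (flashback (dilate c s)).length = (flashback s).length ∧
    ∀ j, 1 ≤ j → j < (flashback s).length →
      (flashback (dilate c s)).getD j default =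
        ⟨dilate c ((flashback s).getD j default).sym,
          c * ((flashback s).getD j default).split⟩ := by
  have key : peelF ((dilate c s).length + 1) ((dilate c s).map (Sum.inl : α → Symb α)) =
      (peelF (s.length + 1) (s.map Sum.inl)).map (Tok.dilate c) := by
    rw [← dilate_map]
    exact peelF_dilate hc _ _ _ (by simp) (by simp [length_dilate])
  rw [flashback_eq_cons hs, flashback_eq_cons (mt (dilate_eq_nil_iff hc).mp hs), key]
  refine ⟨by simp, ?_⟩
  rintro (_ | j) h1 hj
  · omega
  · rw [List.length_cons, Nat.add_lt_add_iff_right] at hj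
    simp [List.getD_eq_getElem?_getD, hj, Tok.dilate]
end
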